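/- Let X ∈ ℝ^{n×d}, Y ∈ ℝ^n, η > 0, σ ≥ 0, χ ∈ (0, 1/2], k ∈ ℕ with k ≥ 1, ζ ∈ ℝ^d, and θ_t ∈ ℝ^d. Let X̄_η := [X; η·I_d] ∈ ℝ^{(n+d)×d} be the vertical stacking of X and η·I_d, let M := X^⊤X + η²·I_d, and let θ*(η²) := M^{-1}X^⊤Y. Suppose B ∈ ℝ^{k×(n+d)} satisfies the conditions A₁(X̄_η,χ,k) and A₂(X̄_η,χ,k), and define θ_{t+1} := θ_t + ((1/k)·(B X̄_η)^⊤(B X̄_η))^{-1}·(X^⊤(Y − Xθ_t) − η²·θ_t + σ·ζ). Then ‖θ_{t+1} − θ*(η²)‖²_M ≤ (2/(1 − χ/2)²)·σ²·‖ζ‖²/(λ_min(X^⊤X) + η²) + 2χ²·‖θ_t − θ*(η²)‖²_M. -/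

import Mathlib

open Matrix

/-- The smallest eigenvalue of a real symmetric matrix, characterized as the infimum of
`v ⬝ᵥ M *ᵥ v` over (Euclidean) unit vectors `v`. -/
noncomputable def lambdaMin {d : ℕ} (M : Matrix (Fin d) (Fin d) ℝ) : ℝ :=
  sInf {r : ℝ | ∃ v : Fin d → ℝ, v ⬝ᵥ v = 1 ∧ r = v ⬝ᵥ (M *ᵥ v)}

/-- Sketching condition `A₁(A,χ,k)`:
`|uᵀ((1/k)·BᵀB − I)Av| ≤ (χ/2)·‖u‖·‖Av‖` for all `u, v`. -/
def condA1 {κ m δ : Type*} [Fintype κ] [Fintype m] [DecidableEq m] [Fintype δ]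
    (A : Matrix m δ ℝ) (χ : ℝ) (k : ℕ) (B : Matrix κ m ℝ) : Prop :=
  ∀ (u : m → ℝ) (v : δ → ℝ),
    |u ⬝ᵥ ((((k : ℝ)⁻¹ • (Bᵀ * B)) - 1) *ᵥ (A *ᵥ v))| ≤
      (χ / 2) * Real.sqrt (u ⬝ᵥ u) * Real.sqrt ((A *ᵥ v) ⬝ᵥ (A *ᵥ v))

/-- Sketching condition `A₂(A,χ,k)`: `‖BAv‖² ≥ k·(1−χ)·‖Av‖²` for all `v`. -/
def condA2 {κ m δ : Type*} [Fintype κ] [Fintype m] [Fintype δ]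
    (A : Matrix m δ ℝ) (χ : ℝ) (k : ℕ) (B : Matrix κ m ℝ) : Prop :=
  ∀ v : δ → ℝ,
    ((B * A) *ᵥ v) ⬝ᵥ ((B * A) *ᵥ v) ≥ (k : ℝ) * (1 - χ) * ((A *ᵥ v) ⬝ᵥ (A *ᵥ v))

theorem dotProduct_self_nonneg_real {ι : Type*} [Fintype ι] (v : ι → ℝ) : 0 ≤ v ⬝ᵥ v := by
  simpa using dotProduct_star_self_nonneg v

theorem isUnit_det_of_le_dotProduct_mulVec {ι : Type*} [Fintype ι] [DecidableEq ι]
    {M : Matrix ι ι ℝ} {c : ℝ} (hc : 0 < c)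
    (h : ∀ v : ι → ℝ, c * (v ⬝ᵥ v) ≤ v ⬝ᵥ (M *ᵥ v)) : IsUnit M.det := by
  rw [isUnit_iff_ne_zero]
  intro hdet
  obtain ⟨v, hv, hMv⟩ := Matrix.exists_mulVec_eq_zero_iff.mpr hdet
  have hle := h v
  rw [hMv, dotProduct_zero] at hle
  have hpos : 0 < v ⬝ᵥ v := lt_of_le_of_ne (dotProduct_self_nonneg_real v)
    (fun h0 => hv (dotProduct_self_eq_zero.mp h0.symm))
  nlinarith [mul_pos hc hpos]

theorem mulVec_dotProduct_mulVec_mulVec {m ι : Type*} [Fintype m] [Fintype ι]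
    (A : Matrix m ι ℝ) (C : Matrix m m ℝ) (u v : ι → ℝ) :
    (A *ᵥ u) ⬝ᵥ (C *ᵥ (A *ᵥ v)) = u ⬝ᵥ ((Aᵀ * C * A) *ᵥ v) := by
  rw [← mulVec_mulVec, ← mulVec_mulVec, dotProduct_mulVec u, vecMul_transpose]

theorem dotProduct_transpose_mul_self_mulVec {m ι : Type*} [Fintype m] [Fintype ι]
    (A : Matrix m ι ℝ) (u v : ι → ℝ) :
    u ⬝ᵥ ((Aᵀ * A) *ᵥ v) = (A *ᵥ u) ⬝ᵥ (A *ᵥ v) := by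
  rw [← mulVec_mulVec, dotProduct_mulVec u, vecMul_transpose]

theorem dotProduct_sq_le {ι : Type*} [Fintype ι] (u v : ι → ℝ) :
    (u ⬝ᵥ v) ^ 2 ≤ (u ⬝ᵥ u) * (v ⬝ᵥ v) := by
  simpa [dotProduct, sq] using Finset.sum_mul_sq_le_sq_mul_sq Finset.univ u v

theorem lambdaMin_transpose_mul_self_nonneg {m : Type*} [Fintype m] {d : ℕ}
    (A : Matrix m (Fin d) ℝ) : 0 ≤ lambdaMin (Aᵀ * A) := by
  apply Real.sInf_nonneg
  rintro r ⟨v, -, rfl⟩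
  rw [dotProduct_transpose_mul_self_mulVec]
  exact dotProduct_self_nonneg_real _

theorem lambdaMin_transpose_mul_self_mul_le {m : Type*} [Fintype m] {d : ℕ}
    (A : Matrix m (Fin d) ℝ) (v : Fin d → ℝ) :
    lambdaMin (Aᵀ * A) * (v ⬝ᵥ v) ≤ v ⬝ᵥ ((Aᵀ * A) *ᵥ v) := by
  rcases eq_or_ne v 0 with rfl | hv
  · simp
  have hpos : 0 < v ⬝ᵥ v := lt_of_le_of_ne (dotProduct_self_nonneg_real v)
    (fun h0 => hv (dotProduct_self_eq_zero.mp h0.symm))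
  set s := Real.sqrt (v ⬝ᵥ v)
  have hs : s * s = v ⬝ᵥ v := Real.mul_self_sqrt hpos.le
  have hs0 : s ≠ 0 := (Real.sqrt_pos.mpr hpos).ne'
  have hle : lambdaMin (Aᵀ * A) ≤ (s⁻¹ • v) ⬝ᵥ ((Aᵀ * A) *ᵥ (s⁻¹ • v)) := by
    refine csInf_le ⟨0, ?_⟩ ⟨s⁻¹ • v, ?_, rfl⟩
    · rintro r ⟨w, -, rfl⟩
      rw [dotProduct_transpose_mul_self_mulVec]
      exact dotProduct_self_nonneg_real _
    · rw [smul_dotProduct, dotProduct_smul, ← hs, smul_eq_mul, smul_eq_mul]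
      field_simp
  rw [mulVec_smul, smul_dotProduct, dotProduct_smul, smul_eq_mul, smul_eq_mul] at hle
  calc lambdaMin (Aᵀ * A) * (v ⬝ᵥ v)
      ≤ s⁻¹ * (s⁻¹ * (v ⬝ᵥ ((Aᵀ * A) *ᵥ v))) * (v ⬝ᵥ v) :=
        mul_le_mul_of_nonneg_right hle hpos.le
    _ = v ⬝ᵥ ((Aᵀ * A) *ᵥ v) := by
        rw [← hs]
        field_simp

theorem sq_le_of_mul_sq_le {a b z σ χ : ℝ} (ha : 0 ≤ a) (hb : 0 ≤ b)
    (hz : 0 ≤ z) (hσ : 0 ≤ σ) (hχ0 : 0 < χ) (hχ : χ ≤ 1 / 2)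
    (h : (1 - χ / 2) * a ^ 2 ≤ χ / 2 * a * b + σ * (a * z)) :
    a ^ 2 ≤ 2 / (1 - χ / 2) ^ 2 * σ ^ 2 * z ^ 2 + 2 * χ ^ 2 * b ^ 2 := by
  have hc : 0 < 1 - χ / 2 := by linarith
  have hlin : (1 - χ / 2) * a ≤ χ / 2 * b + σ * z := by
    rcases ha.eq_or_lt with rfl | ha
    · rw [mul_zero]
      positivity
    · refine le_of_mul_le_mul_right ?_ ha
      linarith
  have hsq : ((1 - χ / 2) * a) ^ 2 ≤ (χ / 2 * b + σ * z) ^ 2 :=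
    pow_le_pow_left₀ (by positivity) hlin 2
  have hc2 : 1 / 4 ≤ (1 - χ / 2) ^ 2 := by nlinarith
  have hb2 : 1 / 4 * (χ * b) ^ 2 ≤ (1 - χ / 2) ^ 2 * (χ * b) ^ 2 :=
    mul_le_mul_of_nonneg_right hc2 (sq_nonneg _)
  have key : (1 - χ / 2) ^ 2 * a ^ 2 ≤
      2 * σ ^ 2 * z ^ 2 + (1 - χ / 2) ^ 2 * (2 * χ ^ 2 * b ^ 2) := by
    nlinarith [sq_nonneg (χ / 2 * b - σ * z)]
  refine le_of_mul_le_mul_left (key.trans_eq ?_) (by positivity : 0 < (1 - χ / 2) ^ 2)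
  have hcancel : (1 - χ / 2) ^ 2 * (2 / (1 - χ / 2) ^ 2) = 2 :=
    mul_div_cancel₀ _ (by positivity)
  linear_combination (-(σ ^ 2 * z ^ 2)) * hcancel

theorem transpose_mul_self_fromRows_smul_one {m ι : Type*} [Fintype m] [Fintype ι]
    [DecidableEq ι] (X : Matrix m ι ℝ) (η : ℝ) :
    (fromRows X (η • (1 : Matrix ι ι ℝ)))ᵀ * fromRows X (η • (1 : Matrix ι ι ℝ)) =
      Xᵀ * X + η ^ 2 • (1 : Matrix ι ι ℝ) := by
  rw [transpose_fromRows, fromCols_mul_fromRows]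
  simp [smul_smul, sq]

/-- one-step contraction bound for the noisy iterative Hessian sketch
recursion with augmented matrix `X̄_η = [X; η·I]`, in the `M = XᵀX + η²·I` weighted norm. -/
theorem stmt12 {n d k : ℕ} (hk : 1 ≤ k)
    (X : Matrix (Fin n) (Fin d) ℝ) (Y : Fin n → ℝ)
    (η : ℝ) (hη : 0 < η) (σ : ℝ) (hσ : 0 ≤ σ)
    (χ : ℝ) (hχ : χ ∈ Set.Ioc (0 : ℝ) (1 / 2))
    (ζ θt : Fin d → ℝ)
    (B : Matrix (Fin k) (Fin n ⊕ Fin d) ℝ)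
    (hB1 : condA1 (Matrix.fromRows X (η • (1 : Matrix (Fin d) (Fin d) ℝ))) χ k B)
    (hB2 : condA2 (Matrix.fromRows X (η • (1 : Matrix (Fin d) (Fin d) ℝ))) χ k B) :
    let Xbar : Matrix (Fin n ⊕ Fin d) (Fin d) ℝ :=
      Matrix.fromRows X (η • (1 : Matrix (Fin d) (Fin d) ℝ))
    let M : Matrix (Fin d) (Fin d) ℝ := Xᵀ * X + η ^ 2 • (1 : Matrix (Fin d) (Fin d) ℝ)
    let θs : Fin d → ℝ := M⁻¹ *ᵥ (Xᵀ *ᵥ Y)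
    let θnext : Fin d → ℝ :=
      θt + ((k : ℝ)⁻¹ • ((B * Xbar)ᵀ * (B * Xbar)))⁻¹ *ᵥ
        (Xᵀ *ᵥ (Y - X *ᵥ θt) - η ^ 2 • θt + σ • ζ)
    (θnext - θs) ⬝ᵥ (M *ᵥ (θnext - θs)) ≤
      (2 / (1 - χ / 2) ^ 2) * σ ^ 2 * (ζ ⬝ᵥ ζ) / (lambdaMin (Xᵀ * X) + η ^ 2) +
        2 * χ ^ 2 * ((θt - θs) ⬝ᵥ (M *ᵥ (θt - θs))) := by
  intro Xbar M θs θnext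
  obtain ⟨hχ0, hχ2⟩ := hχ
  have hXM : Xbarᵀ * Xbar = M := transpose_mul_self_fromRows_smul_one X η
  have hnorm (v : Fin d → ℝ) : (Xbar *ᵥ v) ⬝ᵥ (Xbar *ᵥ v) = v ⬝ᵥ (M *ᵥ v) := by
    rw [← hXM, dotProduct_transpose_mul_self_mulVec]
  have hM0 (v : Fin d → ℝ) : 0 ≤ v ⬝ᵥ (M *ᵥ v) := hnorm v ▸ dotProduct_self_nonneg_real _
  set L := lambdaMin (Xᵀ * X) + η ^ 2 with hL
  have hL0 : 0 < L := by
    have := lambdaMin_transpose_mul_self_nonneg X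
    positivity
  have hML (v : Fin d → ℝ) : L * (v ⬝ᵥ v) ≤ v ⬝ᵥ (M *ᵥ v) := by
    have := lambdaMin_transpose_mul_self_mul_le X v
    simp only [M, hL, add_mulVec, dotProduct_add, smul_mulVec, one_mulVec, dotProduct_smul,
      smul_eq_mul]
    linarith
  have hMdet : IsUnit M.det := isUnit_det_of_le_dotProduct_mulVec hL0 hML
  set H : Matrix (Fin d) (Fin d) ℝ := (k : ℝ)⁻¹ • ((B * Xbar)ᵀ * (B * Xbar)) with hH
  have hdiff : Xbarᵀ * ((k : ℝ)⁻¹ • (Bᵀ * B) - 1) * Xbar = H - M := by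
    rw [← hXM, hH, transpose_mul, Matrix.mul_sub, Matrix.sub_mul, Matrix.mul_one,
      Matrix.mul_smul, Matrix.smul_mul]
    simp only [Matrix.mul_assoc]
  have hsketch (u v : Fin d → ℝ) : |u ⬝ᵥ ((H - M) *ᵥ v)| ≤
      χ / 2 * √(u ⬝ᵥ (M *ᵥ u)) * √(v ⬝ᵥ (M *ᵥ v)) := by
    have := hB1 (Xbar *ᵥ u) v
    rwa [mulVec_dotProduct_mulVec_mulVec, hdiff, hnorm, hnorm] at this
  have hHlow (v : Fin d → ℝ) : (1 - χ / 2) * (v ⬝ᵥ (M *ᵥ v)) ≤ v ⬝ᵥ (H *ᵥ v) := by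
    have := (abs_le.mp (hsketch v v)).1
    rw [mul_assoc, Real.mul_self_sqrt (hM0 v), sub_mulVec, dotProduct_sub] at this
    linarith
  have hHdet : IsUnit H.det := by
    refine isUnit_det_of_le_dotProduct_mulVec (c := (1 - χ / 2) * L)
      (mul_pos (by linarith) hL0) fun v => le_trans ?_ (hHlow v)
    rw [mul_assoc]
    exact mul_le_mul_of_nonneg_left (hML v) (by linarith)
  have hMθs : M *ᵥ θs = Xᵀ *ᵥ Y := by
    rw [mulVec_mulVec, mul_nonsing_inv _ hMdet, one_mulVec]
  set e := θt - θs with he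
  set w := θnext - θs with hw
  have hHw : H *ᵥ w = (H - M) *ᵥ e + σ • ζ := by
    have hgrad : Xᵀ *ᵥ (Y - X *ᵥ θt) - η ^ 2 • θt + σ • ζ = σ • ζ - M *ᵥ e := by
      rw [he, mulVec_sub M, hMθs, mulVec_sub]
      simp only [M, add_mulVec, smul_mulVec, one_mulVec, mulVec_mulVec]
      abel
    have hwe : w = e + H⁻¹ *ᵥ (σ • ζ - M *ᵥ e) := by
      rw [← hgrad]
      simp only [hw, he, θnext]
      abel
    rw [hwe, mulVec_add, mulVec_mulVec, mul_nonsing_inv _ hHdet, one_mulVec, sub_mulVec]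
    abel
  have hζ0 := dotProduct_self_nonneg_real ζ
  have hwζ : w ⬝ᵥ ζ ≤ √(w ⬝ᵥ (M *ᵥ w)) * √(ζ ⬝ᵥ ζ / L) := by
    rw [← Real.sqrt_mul (hM0 w)]
    refine Real.le_sqrt_of_sq_le ((dotProduct_sq_le w ζ).trans ?_)
    rw [← mul_div_assoc, le_div_iff₀ hL0]
    nlinarith [mul_le_mul_of_nonneg_right (hML w) hζ0]
  have hmain : (1 - χ / 2) * √(w ⬝ᵥ (M *ᵥ w)) ^ 2 ≤
      χ / 2 * √(w ⬝ᵥ (M *ᵥ w)) * √(e ⬝ᵥ (M *ᵥ e)) +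
        σ * (√(w ⬝ᵥ (M *ᵥ w)) * √(ζ ⬝ᵥ ζ / L)) := by
    rw [Real.sq_sqrt (hM0 w)]
    refine (hHlow w).trans ?_
    rw [hHw, dotProduct_add, dotProduct_smul, smul_eq_mul]
    exact add_le_add ((le_abs_self _).trans (hsketch w e)) (mul_le_mul_of_nonneg_left hwζ hσ)
  have hfinal := sq_le_of_mul_sq_le (Real.sqrt_nonneg _) (Real.sqrt_nonneg _)
    (Real.sqrt_nonneg _) hσ hχ0 hχ2 hmain
  rwa [Real.sq_sqrt (hM0 w), Real.sq_sqrt (hM0 e), Real.sq_sqrt (by positivity),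
    ← mul_div_assoc] at hfinal
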